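/- Let n ≥ 3, α ∈ [2,n), σ < α and 1 < p < (n + α − 2σ)/(n − α). Suppose u is a positive radially decreasing function, continuous on ℝⁿ and continuously differentiable on ℝⁿ∖{0}, such that for every x ∈ ℝⁿ the integral ∫_{ℝⁿ} u(y)^p |x−y|^{α−n} |y|^{−σ} dy is finite and u(x) = ∫_{ℝⁿ} u(y)^p |x−y|^{α−n} |y|^{−σ} dy. Then the Pohozaev-type identity in integral form holds: ∫_{ℝⁿ} u(x)^p |x|^{−σ} (x·∇u(x)) dx = −((n−α)/2) ∫_{ℝⁿ} u(x)^{p+1} |x|^{−σ} dx, both integrals being absolutely convergent. -/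

import Mathlib

open MeasureTheory RealInnerProductSpace

noncomputable section

/-- `w : ℝⁿ → ℝ` is radially decreasing if `w(x) = W(‖x‖)` for some
nonincreasing `W : [0,∞) → (0,∞)`. -/
def RadiallyDecreasing {n : ℕ} (w : EuclideanSpace ℝ (Fin n) → ℝ) : Prop :=
  ∃ W : ℝ → ℝ, AntitoneOn W (Set.Ici 0) ∧ (∀ r, 0 ≤ r → 0 < W r) ∧
    ∀ x, w x = W ‖x‖

section Pohozaev

open Metric Filter Topology Pointwise

/-- Young's inequality in the form of the tangent line bound for `b ↦ b ^ (p + 1)` at `a`. -/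
lemma add_one_mul_rpow_mul_le {a b p : ℝ} (ha : 0 ≤ a) (hb : 0 ≤ b) (hp : 0 < p) :
    (p + 1) * (a ^ p * b) ≤ p * a ^ (p + 1) + b ^ (p + 1) := by
  have hp1 : 0 < p + 1 := by linarith
  have h := Real.geom_mean_le_arith_mean2_weighted (w₁ := p / (p + 1)) (w₂ := 1 / (p + 1))
    (p₁ := a ^ (p + 1)) (p₂ := b ^ (p + 1)) (by positivity) (by positivity) (by positivity)
    (by positivity) (by field_simp)
  rw [← Real.rpow_mul ha, ← Real.rpow_mul hb, mul_div_cancel₀ _ hp1.ne',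
    mul_one_div_cancel hp1.ne', Real.rpow_one] at h
  calc (p + 1) * (a ^ p * b)
      ≤ (p + 1) * (p / (p + 1) * a ^ (p + 1) + 1 / (p + 1) * b ^ (p + 1)) := by gcongr
    _ = p * a ^ (p + 1) + b ^ (p + 1) := by field_simp

/-- A function with negative derivative at a zero takes negative values just to the right of it. -/
lemma eventually_neg_nhdsGT_of_hasDerivAt_neg {g : ℝ → ℝ} {a g' : ℝ} (hg : HasDerivAt g g' a)
    (ha : g a = 0) (hneg : g' < 0) : ∀ᶠ t in 𝓝[>] a, g t < 0 := by
  have h := (hasDerivAt_iff_tendsto_slope.1 hg).mono_left (nhdsGT_le_nhdsNE a)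
  filter_upwards [h.eventually_lt_const hneg, self_mem_nhdsWithin] with t ht hta
  have hta : 0 < t - a := sub_pos.2 hta
  rw [slope_def_field, ha, sub_zero, div_neg_iff] at ht
  rcases ht with ht | ht <;> linarith

variable {E : Type*} [NormedAddCommGroup E] [NormedSpace ℝ E] [FiniteDimensional ℝ E]

lemma eventually_mul_comp_inv_smul_rpow_le {u : E → ℝ} (hu : Continuous u) (hpos : ∀ x, 0 < u x) {p s : ℝ}
    (hs : s < 1) (R : ℝ) :
    ∀ᶠ t in 𝓝[>] (1 : ℝ), ∀ x ∈ closedBall (0 : E) R, s * u (t⁻¹ • x) ^ p ≤ u x ^ p := by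
  refine Eventually.filter_mono nhdsWithin_le_nhds ?_
  refine (isCompact_closedBall (0 : E) R).eventually_forall_of_forall_eventually fun x _ ↦ ?_
  have h1 : ContinuousAt (fun z : ℝ × E ↦ s * u (z.1⁻¹ • z.2) ^ p) (1, x) := by
    refine continuousAt_const.mul (ContinuousAt.rpow_const ?_ (.inl (hpos _).ne'))
    exact hu.continuousAt.comp ((continuousAt_fst.inv₀ one_ne_zero).smul continuousAt_snd)
  have h2 : ContinuousAt (fun z : ℝ × E ↦ u z.2 ^ p) (1, x) :=
    ContinuousAt.rpow_const (hu.continuousAt.comp continuousAt_snd) (.inl (hpos _).ne')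
  have hlt : s * u ((1 : ℝ)⁻¹ • x) ^ p < u x ^ p := by
    have := Real.rpow_pos_of_pos (hpos x) p
    rw [inv_one, one_smul]
    nlinarith
  exact (h1.eventually_lt h2 hlt).mono fun _ h ↦ h.le

variable [MeasurableSpace E] [BorelSpace E] {μ : Measure E} [μ.IsAddHaarMeasure]

lemma integrableOn_ball_norm_rpow_neg (hd : 1 ≤ Module.finrank ℝ E) {σ : ℝ}
    (hσ : σ < Module.finrank ℝ E) (R : ℝ) :
    IntegrableOn (fun x : E ↦ ‖x‖ ^ (-σ)) (ball 0 R) μ :=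
  integrableOn_ball_of_norm_le_rpow (C := 1) hd hσ
    (.of_forall fun x ↦ by rw [one_mul, Real.norm_of_nonneg (by positivity)])
    (by fun_prop : Measurable fun x : E ↦ ‖x‖ ^ (-σ)).aestronglyMeasurable

lemma integrableOn_compl_ball_norm_rpow_neg {s : ℝ} (hs : (Module.finrank ℝ E : ℝ) < s) :
    IntegrableOn (fun x : E ↦ ‖x‖ ^ (-s)) (ball 0 1)ᶜ μ := by
  have hs0 : 0 < s := lt_of_le_of_lt (Nat.cast_nonneg _) hs
  refine ((integrable_one_add_norm (μ := μ) hs).integrableOn.const_mul (2 ^ s)).mono'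
    (by fun_prop : Measurable fun x : E ↦ ‖x‖ ^ (-s)).aestronglyMeasurable ?_
  filter_upwards [ae_restrict_mem measurableSet_ball.compl] with x hx
  have hx : 1 ≤ ‖x‖ := by simpa using hx
  rw [Real.norm_of_nonneg (by positivity)]
  calc ‖x‖ ^ (-s) ≤ ((1 + ‖x‖) / 2) ^ (-s) :=
        Real.rpow_le_rpow_of_nonpos (by positivity) (by linarith) (by linarith)
    _ = 2 ^ s * (1 + ‖x‖) ^ (-s) := by
        rw [Real.div_rpow (by positivity) (by norm_num), Real.rpow_neg zero_le_two, div_inv_eq_mul,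
          mul_comm]

/-- Behaviour of the measure `‖x‖ ^ (-σ) dx` under dilations. -/
lemma setIntegral_comp_inv_smul_mul_norm_rpow (h : E → ℝ) (s : Set E) (σ : ℝ) {t : ℝ}
    (ht : 0 < t) :
    ∫ x in t • s, h (t⁻¹ • x) * ‖x‖ ^ (-σ) ∂μ =
      t ^ (Module.finrank ℝ E - σ) * ∫ x in s, h x * ‖x‖ ^ (-σ) ∂μ := by
  have key := Measure.setIntegral_comp_smul_of_pos μ (fun x ↦ h (t⁻¹ • x) * ‖x‖ ^ (-σ)) s ht
  simp only [inv_smul_smul₀ ht.ne', norm_smul, Real.norm_of_nonneg ht.le, smul_eq_mul,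
    Real.mul_rpow ht.le (norm_nonneg _), mul_left_comm _ (t ^ (-σ)), integral_const_mul] at key
  rw [sub_eq_add_neg, Real.rpow_add ht, Real.rpow_natCast, mul_assoc, key,
    mul_inv_cancel_left₀ (by positivity)]

lemma integral_comp_inv_smul_mul_norm_rpow (h : E → ℝ) (σ : ℝ) {t : ℝ} (ht : 0 < t) :
    ∫ x, h (t⁻¹ • x) * ‖x‖ ^ (-σ) ∂μ =
      t ^ (Module.finrank ℝ E - σ) * ∫ x, h x * ‖x‖ ^ (-σ) ∂μ := by
  simpa [Set.smul_set_univ₀ ht.ne'] using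
    setIntegral_comp_inv_smul_mul_norm_rpow (μ := μ) h Set.univ σ ht

lemma setIntegral_ball_norm_rpow (σ : ℝ) {R : ℝ} (hR : 0 < R) :
    ∫ x in ball (0 : E) R, ‖x‖ ^ (-σ) ∂μ =
      R ^ (Module.finrank ℝ E - σ) * ∫ x in ball (0 : E) 1, ‖x‖ ^ (-σ) ∂μ := by
  simpa [smul_unitBall_of_pos hR] using
    setIntegral_comp_inv_smul_mul_norm_rpow (μ := μ) (fun _ ↦ 1) (ball 0 1) σ hR

lemma integrable_comp_smul_mul_norm_rpow {h : E → ℝ} {σ : ℝ}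
    (hh : Integrable (fun x ↦ h x * ‖x‖ ^ (-σ)) μ) {t : ℝ} (ht : 0 < t) :
    Integrable (fun x ↦ h (t • x) * ‖x‖ ^ (-σ)) μ := by
  refine ((hh.comp_smul ht.ne').const_mul (t ^ σ)).congr (.of_forall fun x ↦ ?_)
  simp only [norm_smul, Real.norm_of_nonneg ht.le, Real.mul_rpow ht.le (norm_nonneg _)]
  rw [Real.rpow_neg ht.le]
  field_simp

lemma setIntegral_ball_norm_rpow_pos (hd : 1 ≤ Module.finrank ℝ E) {σ : ℝ}
    (hσ : σ < Module.finrank ℝ E) : 0 < ∫ x in ball (0 : E) 1, ‖x‖ ^ (-σ) ∂μ := by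
  have : Nontrivial E := Module.nontrivial_of_finrank_pos (R := ℝ) hd
  rw [integral_pos_iff_support_of_nonneg (fun x ↦ by positivity)
    (integrableOn_ball_norm_rpow_neg hd hσ 1)]
  refine lt_of_lt_of_le ?_ (measure_mono (s := {0}ᶜ) fun x hx ↦ ?_)
  · rw [Measure.restrict_apply (by measurability), Set.inter_comm, ← Set.sdiff_eq,
      measure_sdiff_null (measure_singleton _)]
    exact measure_ball_pos μ 0 one_pos
  · exact (Real.rpow_pos_of_pos (norm_pos_iff.2 hx) _).ne'

variable {u : E → ℝ} {α σ p : ℝ}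

/-- A positive radially decreasing supersolution of the integral equation decays at infinity. -/
lemma exists_decay_of_potential (hd : 1 ≤ Module.finrank ℝ E) (hσd : σ < Module.finrank ℝ E)
    (hαd : α < Module.finrank ℝ E) (hp : 1 < p) (hpos : ∀ x, 0 < u x)
    (hanti : ∀ x y, ‖x‖ ≤ ‖y‖ → u y ≤ u x)
    (hsol : ∀ x, Integrable
        (fun y ↦ u y ^ p * ‖x - y‖ ^ (α - (Module.finrank ℝ E : ℝ)) * ‖y‖ ^ (-σ)) μ ∧
      u x = ∫ y, u y ^ p * ‖x - y‖ ^ (α - (Module.finrank ℝ E : ℝ)) * ‖y‖ ^ (-σ) ∂μ) :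
    ∃ C, 0 < C ∧ ∀ x, x ≠ 0 → u x ≤ C * ‖x‖ ^ (-((α - σ) / (p - 1))) := by
  set d := (Module.finrank ℝ E : ℝ) with hd'
  set c : ℝ := ∫ x in ball (0 : E) 1, ‖x‖ ^ (-σ) ∂μ with hc
  have hc0 : 0 < c := setIntegral_ball_norm_rpow_pos hd hσd
  have hp' : 0 < p - 1 := by linarith
  refine ⟨(2 ^ (α - d) * c)⁻¹ ^ (p - 1)⁻¹, by positivity, fun x hx ↦ ?_⟩
  have hx0 : 0 < ‖x‖ := norm_pos_iff.2 hx
  have hux := hpos x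
  have key : u x ^ p * (2 * ‖x‖) ^ (α - d) * (‖x‖ ^ (d - σ) * c) ≤ u x := by
    rw [hc, hd', ← setIntegral_ball_norm_rpow σ hx0, ← integral_const_mul]
    conv_rhs => rw [(hsol x).2]
    refine le_trans ?_ (setIntegral_le_integral (s := ball 0 ‖x‖) (hsol x).1
      (.of_forall fun y ↦ ?_))
    · refine setIntegral_mono_on ((integrableOn_ball_norm_rpow_neg hd hσd _).const_mul _)
        (hsol x).1.integrableOn measurableSet_ball fun y hy ↦ ?_
      have hy : ‖y‖ < ‖x‖ := by simpa using hy
      have h1 : 0 < ‖x - y‖ := norm_pos_iff.2 (sub_ne_zero.2 (by rintro rfl; exact hy.ne rfl))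
      have h2 : ‖x - y‖ ≤ 2 * ‖x‖ := (norm_sub_le x y).trans (by linarith)
      have h3 : (2 * ‖x‖) ^ (α - d) ≤ ‖x - y‖ ^ (α - d) :=
        Real.rpow_le_rpow_of_nonpos h1 h2 (by linarith)
      have h4 := hanti y x hy.le
      have h5 := hpos y
      gcongr
    · have := hpos y
      positivity
  have hpow : u x ^ (p - 1) ≤ (2 ^ (α - d) * c)⁻¹ * ‖x‖ ^ (-(α - σ)) := by
    rw [Real.mul_rpow zero_le_two hx0.le] at key
    have e1 : u x ^ p = u x ^ (p - 1) * u x := by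
      rw [← Real.rpow_add_one hux.ne', sub_add_cancel]
    have e2 : ‖x‖ ^ (α - d) * ‖x‖ ^ (d - σ) = ‖x‖ ^ (α - σ) := by
      rw [← Real.rpow_add hx0]; ring_nf
    have e3 : u x ^ (p - 1) * (2 ^ (α - d) * c) * ‖x‖ ^ (α - σ) ≤ 1 := by
      refine le_of_mul_le_mul_right ?_ hux
      rw [← e2, one_mul]
      calc _ = u x ^ p * (2 ^ (α - d) * ‖x‖ ^ (α - d)) * (‖x‖ ^ (d - σ) * c) := by rw [e1]; ring
        _ ≤ u x := key
    rw [Real.rpow_neg hx0.le, ← mul_inv, le_inv_comm₀ (by positivity) (by positivity),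
      le_inv_comm₀ (by positivity) (by positivity), ← one_div, le_div_iff₀ (by positivity)]
    linarith
  calc u x = (u x ^ (p - 1)) ^ (p - 1)⁻¹ := by rw [Real.rpow_rpow_inv hux.le hp'.ne']
    _ ≤ ((2 ^ (α - d) * c)⁻¹ * ‖x‖ ^ (-(α - σ))) ^ (p - 1)⁻¹ := by gcongr
    _ = _ := by
      rw [Real.mul_rpow (by positivity) (by positivity), ← Real.rpow_mul hx0.le]
      ring_nf

lemma integrable_rpow_mul_norm_rpow (hd : 1 ≤ Module.finrank ℝ E)
    (hσd : σ < Module.finrank ℝ E) {q β C : ℝ} (hq : 0 ≤ q)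
    (hβ : Module.finrank ℝ E < β * q + σ) (hu : Continuous u) (hpos : ∀ x, 0 < u x)
    (hanti : ∀ x y, ‖x‖ ≤ ‖y‖ → u y ≤ u x) (hC : 0 < C)
    (hdecay : ∀ x, x ≠ 0 → u x ≤ C * ‖x‖ ^ (-β)) :
    Integrable (fun x ↦ u x ^ q * ‖x‖ ^ (-σ)) μ := by
  have hmeas : Measurable fun x ↦ u x ^ q * ‖x‖ ^ (-σ) := by fun_prop
  rw [← integrableOn_univ, ← Set.union_compl_self (ball (0 : E) 1)]
  refine IntegrableOn.union ?_ ?_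
  · refine ((integrableOn_ball_norm_rpow_neg hd hσd 1).const_mul (u 0 ^ q)).mono'
      hmeas.aestronglyMeasurable (.of_forall fun x ↦ ?_)
    have h0 := hpos x
    have h1 := hanti 0 x (by simp)
    rw [Real.norm_of_nonneg (by positivity)]
    gcongr
  · refine ((integrableOn_compl_ball_norm_rpow_neg hβ).const_mul (C ^ q)).mono'
      hmeas.aestronglyMeasurable ?_
    filter_upwards [ae_restrict_mem measurableSet_ball.compl] with x hx
    have hx : 1 ≤ ‖x‖ := by simpa using hx
    have hx0 : 0 < ‖x‖ := by linarith
    have h0 := hpos x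
    rw [Real.norm_of_nonneg (by positivity)]
    calc u x ^ q * ‖x‖ ^ (-σ) ≤ (C * ‖x‖ ^ (-β)) ^ q * ‖x‖ ^ (-σ) := by
          gcongr; exact hdecay x (norm_pos_iff.1 hx0)
      _ = C ^ q * ‖x‖ ^ (-(β * q + σ)) := by
          rw [Real.mul_rpow hC.le (by positivity), ← Real.rpow_mul hx0.le, mul_assoc,
            ← Real.rpow_add hx0]
          ring_nf

/-- Symmetry of the Riesz energy of `u ^ p * ‖x‖ ^ (-σ)` against its dilations. -/
lemma integral_mul_comp_inv_smul_eq (hu : Continuous u) (hpos : ∀ x, 0 < u x)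
    (hsol : ∀ x, Integrable
        (fun y ↦ u y ^ p * ‖x - y‖ ^ (α - (Module.finrank ℝ E : ℝ)) * ‖y‖ ^ (-σ)) μ ∧
      u x = ∫ y, u y ^ p * ‖x - y‖ ^ (α - (Module.finrank ℝ E : ℝ)) * ‖y‖ ^ (-σ) ∂μ)
    {t : ℝ} (ht : 0 < t) :
    ∫ x, u x ^ p * u (t⁻¹ • x) * ‖x‖ ^ (-σ) ∂μ =
      t ^ (Module.finrank ℝ E - α) * ∫ x, u x ^ p * u (t • x) * ‖x‖ ^ (-σ) ∂μ := by
  set d := (Module.finrank ℝ E : ℝ)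
  let f : E → ℝ := fun x ↦ u x ^ p * ‖x‖ ^ (-σ)
  have hf0 : ∀ x, 0 ≤ f x := fun x ↦ mul_nonneg (Real.rpow_nonneg (hpos x).le _) (by positivity)
  have hfm : Measurable f := by fun_prop
  have energy : ∀ s : ℝ, ∫⁻ x, ENNReal.ofReal (u x ^ p * u (s • x) * ‖x‖ ^ (-σ)) ∂μ =
      ∫⁻ x, ∫⁻ y, ENNReal.ofReal (f x * f y * ‖s • x - y‖ ^ (α - d)) ∂μ ∂μ := fun s ↦ by
    refine lintegral_congr fun x ↦ ?_
    have h : u x ^ p * u (s • x) * ‖x‖ ^ (-σ) =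
        ∫ y, f x * f y * ‖s • x - y‖ ^ (α - d) ∂μ := by
      rw [(hsol (s • x)).2, mul_right_comm, ← integral_const_mul]
      exact integral_congr_ae (.of_forall fun y ↦ by simp only [f]; ring)
    rw [h, ofReal_integral_eq_lintegral_ofReal]
    · refine ((hsol (s • x)).1.const_mul (f x)).congr (.of_forall fun y ↦ ?_)
      simp only [f]; ring
    · exact .of_forall fun y ↦
        mul_nonneg (mul_nonneg (hf0 x) (hf0 y)) (Real.rpow_nonneg (norm_nonneg _) _)
  have symm : ∫⁻ x, ∫⁻ y, ENNReal.ofReal (f x * f y * ‖t⁻¹ • x - y‖ ^ (α - d)) ∂μ ∂μ =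
      ENNReal.ofReal (t ^ (d - α)) *
        ∫⁻ x, ∫⁻ y, ENNReal.ofReal (f x * f y * ‖t • x - y‖ ^ (α - d)) ∂μ ∂μ := by
    rw [lintegral_lintegral_swap (by fun_prop), ← lintegral_const_mul' _ _ ENNReal.ofReal_ne_top]
    refine lintegral_congr fun y ↦ ?_
    rw [← lintegral_const_mul' _ _ ENNReal.ofReal_ne_top]
    refine lintegral_congr fun x ↦ ?_
    rw [← ENNReal.ofReal_mul (by positivity)]
    congr 1
    have h : t⁻¹ • x - y = t⁻¹ • (x - t • y) := by rw [smul_sub, inv_smul_smul₀ ht.ne']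
    rw [h, norm_smul, Real.norm_of_nonneg (by positivity), norm_sub_rev,
      Real.mul_rpow (by positivity) (by positivity), Real.inv_rpow ht.le, ← Real.rpow_neg ht.le,
      neg_sub]
    ring
  have toReal : ∀ s : ℝ, ∫ x, u x ^ p * u (s • x) * ‖x‖ ^ (-σ) ∂μ =
      (∫⁻ x, ENNReal.ofReal (u x ^ p * u (s • x) * ‖x‖ ^ (-σ)) ∂μ).toReal := fun s ↦
    integral_eq_lintegral_of_nonneg_ae (.of_forall fun x ↦ mul_nonneg
      (mul_nonneg (Real.rpow_nonneg (hpos x).le _) (hpos _).le) (by positivity))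
      (by fun_prop : Measurable fun x ↦ u x ^ p * u (s • x) * ‖x‖ ^ (-σ)).aestronglyMeasurable
  rw [toReal, toReal, energy, energy, symm, ENNReal.toReal_mul,
    ENNReal.toReal_ofReal (by positivity)]

/-- Lower bound for the growth under dilations of `∫ u ^ q * ‖x‖ ^ (-σ)` over a ball. -/
lemma mul_le_setIntegral_sub (hd : 1 ≤ Module.finrank ℝ E) (hσd : σ < Module.finrank ℝ E)
    {q K ρ t : ℝ} (hq : 0 ≤ q) (hpos : ∀ x, 0 < u x)
    (hint : Integrable (fun x ↦ u x ^ q * ‖x‖ ^ (-σ)) μ) (hρ : 0 < ρ) (ht : 1 < t)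
    (hK : ∀ x, ρ ≤ ‖x‖ → u x ≤ K) :
    (t ^ (Module.finrank ℝ E - σ) - 1) * (∫ x in ball 0 ρ, u x ^ q * ‖x‖ ^ (-σ) ∂μ -
        K ^ q * (ρ ^ (Module.finrank ℝ E - σ) * ∫ x in ball (0 : E) 1, ‖x‖ ^ (-σ) ∂μ)) ≤
      ∫ x in ball 0 (t * ρ), (u (t⁻¹ • x) ^ q * ‖x‖ ^ (-σ) - u x ^ q * ‖x‖ ^ (-σ)) ∂μ := by
  have ht0 : 0 < t := by linarith
  have hball : t • ball (0 : E) ρ = ball 0 (t * ρ) := by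
    rw [_root_.smul_ball ht0.ne', smul_zero, Real.norm_of_nonneg ht0.le]
  have hsub : ball (0 : E) ρ ⊆ ball 0 (t * ρ) := ball_subset_ball (by nlinarith)
  have hw : ∀ R, IntegrableOn (fun x : E ↦ ‖x‖ ^ (-σ)) (ball 0 R) μ :=
    integrableOn_ball_norm_rpow_neg hd hσd
  rw [integral_sub (integrable_comp_smul_mul_norm_rpow (h := fun x ↦ u x ^ q) hint
      (inv_pos.2 ht0)).integrableOn hint.integrableOn, ← hball,
    setIntegral_comp_inv_smul_mul_norm_rpow (fun x ↦ u x ^ q) _ σ ht0, hball]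
  have hshell : ∫ x in ball 0 (t * ρ) \ ball 0 ρ, u x ^ q * ‖x‖ ^ (-σ) ∂μ ≤
      ∫ x in ball 0 (t * ρ) \ ball 0 ρ, K ^ q * ‖x‖ ^ (-σ) ∂μ := by
    refine setIntegral_mono_on hint.integrableOn
      (((hw (t * ρ)).mono_set Set.sdiff_subset).const_mul _)
      (measurableSet_ball.diff measurableSet_ball) fun x hx ↦ ?_
    have h0 := hpos x
    have h1 : ρ ≤ ‖x‖ := by simpa using hx.2
    have h2 := hK x h1
    gcongr
  rw [integral_const_mul, setIntegral_sdiff measurableSet_ball hint.integrableOn hsub,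
    setIntegral_sdiff measurableSet_ball (hw _) hsub,
    setIntegral_ball_norm_rpow σ (by positivity : 0 < t * ρ), setIntegral_ball_norm_rpow σ hρ,
    Real.mul_rpow ht0.le hρ.le] at hshell
  linarith

lemma integrable_rpow_mul_comp_smul_mul (hp : 0 < p) (hu : Continuous u) (hpos : ∀ x, 0 < u x)
    (hint : Integrable (fun x ↦ u x ^ (p + 1) * ‖x‖ ^ (-σ)) μ) {t : ℝ} (ht : 0 < t) :
    Integrable (fun x ↦ u x ^ p * u (t • x) * ‖x‖ ^ (-σ)) μ := by
  have ht' := integrable_comp_smul_mul_norm_rpow (h := fun x ↦ u x ^ (p + 1)) hint ht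
  refine ((hint.const_mul p).add ht').mono'
    (by fun_prop : Measurable fun x ↦ u x ^ p * u (t • x) * ‖x‖ ^ (-σ)).aestronglyMeasurable
    (.of_forall fun x ↦ ?_)
  have h0 := hpos x
  have h1 := hpos (t • x)
  have h2 := add_one_mul_rpow_mul_le h0.le h1.le hp
  have h3 : u x ^ p * u (t • x) ≤ p * u x ^ (p + 1) + u (t • x) ^ (p + 1) := by
    have : 0 < p * (u x ^ p * u (t • x)) := by positivity
    linarith
  rw [Real.norm_of_nonneg (by positivity)]
  calc _ ≤ (p * u x ^ (p + 1) + u (t • x) ^ (p + 1)) * ‖x‖ ^ (-σ) := by gcongr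
    _ = _ := by simp only [Pi.add_apply]; ring

lemma integral_rpow_mul_comp_smul_mul_le (hp : 0 < p) (hu : Continuous u) (hpos : ∀ x, 0 < u x)
    (hint : Integrable (fun x ↦ u x ^ (p + 1) * ‖x‖ ^ (-σ)) μ) {t : ℝ} (ht : 0 < t) :
    (p + 1) * ∫ x, u x ^ p * u (t • x) * ‖x‖ ^ (-σ) ∂μ ≤
      (p + t ^ (-(Module.finrank ℝ E - σ))) * ∫ x, u x ^ (p + 1) * ‖x‖ ^ (-σ) ∂μ := by
  have ht' := integrable_comp_smul_mul_norm_rpow (h := fun x ↦ u x ^ (p + 1)) hint ht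
  have hscale := integral_comp_inv_smul_mul_norm_rpow (μ := μ) (fun x ↦ u x ^ (p + 1)) σ
    (inv_pos.2 ht)
  rw [inv_inv, Real.inv_rpow ht.le, ← Real.rpow_neg ht.le] at hscale
  rw [add_mul p (t ^ _), ← hscale, ← integral_const_mul, ← integral_const_mul,
    ← integral_add (hint.const_mul p) ht']
  refine integral_mono ((integrable_rpow_mul_comp_smul_mul hp hu hpos hint ht).const_mul _)
    ((hint.const_mul p).add ht') fun x ↦ ?_
  have h2 := add_one_mul_rpow_mul_le (hpos x).le (hpos (t • x)).le hp
  calc (p + 1) * (u x ^ p * u (t • x) * ‖x‖ ^ (-σ))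
      = (p + 1) * (u x ^ p * u (t • x)) * ‖x‖ ^ (-σ) := by ring
    _ ≤ (p * u x ^ (p + 1) + u (t • x) ^ (p + 1)) * ‖x‖ ^ (-σ) := by gcongr
    _ = _ := by ring

lemma mul_setIntegral_sub_le (hp : 0 < p) (hu : Continuous u) (hpos : ∀ x, 0 < u x)
    (hanti : ∀ x y, ‖x‖ ≤ ‖y‖ → u y ≤ u x)
    (hint : Integrable (fun x ↦ u x ^ (p + 1) * ‖x‖ ^ (-σ)) μ) {s R t : ℝ} (hs : 0 ≤ s)
    (ht : 1 < t) (hst : ∀ x ∈ ball (0 : E) R, s * u (t⁻¹ • x) ^ p ≤ u x ^ p) :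
    s * ∫ x in ball 0 R, (u (t⁻¹ • x) ^ (p + 1) * ‖x‖ ^ (-σ) - u x ^ (p + 1) * ‖x‖ ^ (-σ)) ∂μ ≤
      (p + 1) * (∫ x, u x ^ p * u (t⁻¹ • x) * ‖x‖ ^ (-σ) ∂μ -
        ∫ x, u x ^ (p + 1) * ‖x‖ ^ (-σ) ∂μ) := by
  have ht0 : 0 < t⁻¹ := inv_pos.2 (by linarith)
  have ht' := integrable_comp_smul_mul_norm_rpow (h := fun x ↦ u x ^ (p + 1)) hint ht0
  have hprod := integrable_rpow_mul_comp_smul_mul hp hu hpos hint ht0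
  have hmono : ∀ x, u x ≤ u (t⁻¹ • x) := fun x ↦ hanti _ _ <| by
    rw [norm_smul, Real.norm_of_nonneg ht0.le]
    exact mul_le_of_le_one_left (norm_nonneg x) (inv_le_one_of_one_le₀ ht.le)
  have hsucc : ∀ x, u x ^ (p + 1) = u x ^ p * u x := fun x ↦ Real.rpow_add_one (hpos x).ne' p
  rw [← integral_sub hprod hint, ← integral_const_mul, ← integral_const_mul]
  refine le_trans ?_ (setIntegral_le_integral (s := ball 0 R) ((hprod.sub hint).const_mul _)
    (.of_forall fun x ↦ ?_))
  · refine setIntegral_mono_on ((ht'.sub hint).integrableOn.const_mul _)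
      ((hprod.sub hint).integrableOn.const_mul _) measurableSet_ball fun x hx ↦ ?_
    set v := u (t⁻¹ • x) with hv
    have hv0 : 0 < v := hpos _
    have h2 := add_one_mul_rpow_mul_le hv0.le (hpos x).le hp
    have h3 : v ^ (p + 1) - u x ^ (p + 1) ≤ (p + 1) * (v ^ p * (v - u x)) := by
      have : v ^ (p + 1) = v ^ p * v := Real.rpow_add_one hv0.ne' p
      rw [this] at h2 ⊢
      linarith
    have h4 : 0 ≤ v - u x := sub_nonneg.2 (hmono x)
    calc s * (v ^ (p + 1) * ‖x‖ ^ (-σ) - u x ^ (p + 1) * ‖x‖ ^ (-σ))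
        = s * (v ^ (p + 1) - u x ^ (p + 1)) * ‖x‖ ^ (-σ) := by ring
      _ ≤ s * ((p + 1) * (v ^ p * (v - u x))) * ‖x‖ ^ (-σ) := by gcongr
      _ = (p + 1) * (s * v ^ p * (v - u x)) * ‖x‖ ^ (-σ) := by ring
      _ ≤ (p + 1) * (u x ^ p * (v - u x)) * ‖x‖ ^ (-σ) := by
          gcongr; exact hst x hx
      _ = _ := by simp only [hsucc]; ring
  · have h4 : 0 ≤ u (t⁻¹ • x) - u x := sub_nonneg.2 (hmono x)
    have h0 := hpos x
    have : (p + 1) * (u x ^ p * u (t⁻¹ • x) * ‖x‖ ^ (-σ) - u x ^ (p + 1) * ‖x‖ ^ (-σ)) =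
        (p + 1) * (u x ^ p * (u (t⁻¹ • x) - u x) * ‖x‖ ^ (-σ)) := by rw [hsucc]; ring
    simp only [Pi.zero_apply, this]
    positivity

/-- The integral equation has no positive radially decreasing solution in the subcritical range. -/
theorem no_radiallyDecreasing_solution (hd : 1 ≤ Module.finrank ℝ E)
    (hαd : α < Module.finrank ℝ E) (hσ : σ < α) (hp1 : 1 < p)
    (hp : p < (Module.finrank ℝ E + α - 2 * σ) / (Module.finrank ℝ E - α))
    (hpos : ∀ x, 0 < u x) (hanti : ∀ x y, ‖x‖ ≤ ‖y‖ → u y ≤ u x) (hu : Continuous u)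
    (hsol : ∀ x, Integrable
        (fun y ↦ u y ^ p * ‖x - y‖ ^ (α - (Module.finrank ℝ E : ℝ)) * ‖y‖ ^ (-σ)) μ ∧
      u x = ∫ y, u y ^ p * ‖x - y‖ ^ (α - (Module.finrank ℝ E : ℝ)) * ‖y‖ ^ (-σ) ∂μ) :
    False := by
  have hσd : σ < Module.finrank ℝ E := hσ.trans hαd
  have hp0 : 0 < p := by linarith
  obtain ⟨C, hC, hdecay⟩ := exists_decay_of_potential hd hσd hαd hp1 hpos hanti hsol
  set d := (Module.finrank ℝ E : ℝ) with hd'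
  set β : ℝ := (α - σ) / (p - 1) with hβ
  have hβ0 : 0 < β := div_pos (by linarith) (by linarith)
  have hsub : p * (d - α) < d + α - 2 * σ := (lt_div_iff₀ (by linarith)).1 hp
  have hβq : d < β * (p + 1) + σ := by
    have : β * (p - 1) = α - σ := div_mul_cancel₀ _ (by linarith)
    refine lt_of_mul_lt_mul_right ?_ (by linarith : 0 ≤ p - 1)
    calc d * (p - 1) < (α - σ) * (p + 1) + σ * (p - 1) := by linarith
      _ = _ := by rw [← this]; ring
  have hint : Integrable (fun x ↦ u x ^ (p + 1) * ‖x‖ ^ (-σ)) μ :=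
    integrable_rpow_mul_norm_rpow hd hσd (by linarith) hβq hu hpos hanti hC hdecay
  set A := ∫ x, u x ^ (p + 1) * ‖x‖ ^ (-σ) ∂μ with hA
  set c := ∫ x in ball (0 : E) 1, ‖x‖ ^ (-σ) ∂μ with hc
  have hc0 : 0 < c := setIntegral_ball_norm_rpow_pos hd hσd
  have hA0 : 0 < A := by
    have : Nontrivial E := Module.nontrivial_of_finrank_pos (R := ℝ) hd
    rw [hA, integral_pos_iff_support_of_nonneg (fun x ↦ mul_nonneg
      (Real.rpow_nonneg (hpos x).le _) (by positivity)) hint]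
    refine (isOpen_compl_singleton.measure_pos μ (exists_ne (0 : E))).trans_le
      (measure_mono fun x hx ↦ ?_)
    exact (mul_pos (Real.rpow_pos_of_pos (hpos x) _)
      (Real.rpow_pos_of_pos (norm_pos_iff.2 hx) _)).ne'
  obtain ⟨s, hs0, hs1, hs⟩ : ∃ s : ℝ, 0 < s ∧ s < 1 ∧
      (d - α) * (p + 1) - (d - σ) - s ^ 2 * (d - σ) < 0 := by
    have hcont : ContinuousAt
        (fun s : ℝ ↦ (d - α) * (p + 1) - (d - σ) - s ^ 2 * (d - σ)) 1 := by fun_prop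
    have h := hcont.eventually_lt (continuousAt_const (y := (0 : ℝ))) (by linarith)
    have h' : ∀ᶠ s in 𝓝[<] (1 : ℝ), 0 < s :=
      nhdsWithin_le_nhds (lt_mem_nhds one_pos)
    obtain ⟨s, ⟨h1, h2⟩, h3⟩ := ((h.filter_mono nhdsWithin_le_nhds).and h' |>.and
      (self_mem_nhdsWithin (s := Set.Iio (1 : ℝ)))).exists
    exact ⟨s, h2, h3, h1⟩
  obtain ⟨ρ, hρ, hρA⟩ : ∃ ρ : ℝ, 0 < ρ ∧ s * A <
      ∫ x in ball 0 ρ, u x ^ (p + 1) * ‖x‖ ^ (-σ) ∂μ -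
        (C * ρ ^ (-β)) ^ (p + 1) * (ρ ^ (d - σ) * c) := by
    have hM : Tendsto (fun ρ : ℝ ↦ ∫ x in ball 0 ρ, u x ^ (p + 1) * ‖x‖ ^ (-σ) ∂μ) atTop (𝓝 A) :=
      (aecover_ball tendsto_id).integral_tendsto_of_countably_generated hint
    have htail : Tendsto (fun ρ : ℝ ↦ (C * ρ ^ (-β)) ^ (p + 1) * (ρ ^ (d - σ) * c)) atTop
        (𝓝 0) := by
      have h := (tendsto_rpow_neg_atTop (by linarith : 0 < β * (p + 1) + σ - d)).const_mul
        (C ^ (p + 1) * c)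
      rw [mul_zero] at h
      refine h.congr' ?_
      filter_upwards [eventually_gt_atTop 0] with ρ hρ
      rw [Real.mul_rpow hC.le (by positivity), ← Real.rpow_mul hρ.le]
      have : ρ ^ (-(β * (p + 1) + σ - d)) = ρ ^ (-β * (p + 1)) * ρ ^ (d - σ) := by
        rw [← Real.rpow_add hρ]; ring_nf
      rw [this]
      ring
    have h := (hM.sub htail).eventually_const_lt
      (by rw [sub_zero]; exact mul_lt_of_lt_one_left hA0 hs1 : s * A < A - 0)
    obtain ⟨ρ, h1, h2⟩ := (h.and (eventually_gt_atTop 0)).exists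
    exact ⟨ρ, h2, h1⟩
  have hK : ∀ x : E, ρ ≤ ‖x‖ → u x ≤ C * ρ ^ (-β) := fun x hx ↦
    (hdecay x (norm_pos_iff.1 (hρ.trans_le hx))).trans <| mul_le_mul_of_nonneg_left
      (Real.rpow_le_rpow_of_nonpos hρ hx (by linarith)) hC.le
  let g : ℝ → ℝ := fun t ↦
    t ^ (d - α) * (p + t ^ (-(d - σ))) - (p + 1) - s ^ 2 * (t ^ (d - σ) - 1)
  have hg : HasDerivAt g ((d - α) * (p + 1) - (d - σ) - s ^ 2 * (d - σ)) 1 := by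
    have hr : ∀ r : ℝ, HasDerivAt (fun t : ℝ ↦ t ^ r) r 1 := fun r ↦ by
      simpa using Real.hasDerivAt_rpow_const (x := 1) (p := r) (.inl one_ne_zero)
    refine ((((hr (d - α)).mul ((hr (-(d - σ))).const_add p)).sub_const (p + 1)).sub
      (((hr (d - σ)).sub_const 1).const_mul (s ^ 2))).congr_deriv ?_
    simp only [Real.one_rpow]
    ring
  have hneg := eventually_neg_nhdsGT_of_hasDerivAt_neg hg (by simp [g]) hs
  have hlt2 : ∀ᶠ t in 𝓝[>] (1 : ℝ), t < 2 :=
    nhdsWithin_le_nhds (gt_mem_nhds one_lt_two)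
  obtain ⟨t, ⟨⟨hgt, hcomp⟩, ht2⟩, ht1⟩ := ((hneg.and
    (eventually_mul_comp_inv_smul_rpow_le (p := p) hu hpos hs1 (2 * ρ))).and hlt2 |>.and
      (self_mem_nhdsWithin (s := Set.Ioi (1 : ℝ)))).exists
  have ht1 : 1 < t := ht1
  have ht0 : 0 < t := by linarith
  have hlow := mul_le_setIntegral_sub hd hσd (by linarith) hpos hint hρ ht1 hK
  have hmid := mul_setIntegral_sub_le hp0 hu hpos hanti hint hs0.le ht1 (R := t * ρ)
    fun x hx ↦ hcomp x (by
      rw [mem_ball_zero_iff] at hx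
      rw [mem_closedBall_zero_iff]
      nlinarith)
  have hup := integral_rpow_mul_comp_smul_mul_le hp0 hu hpos hint ht0
  rw [integral_mul_comp_inv_smul_eq hu hpos hsol ht0] at hmid
  rw [← hd'] at hlow hmid hup
  have htm : 0 < t ^ (d - σ) - 1 := sub_pos.2 (Real.one_lt_rpow ht1 (by linarith))
  have h1 : s * ((t ^ (d - σ) - 1) * (s * A)) ≤
      t ^ (d - α) * ((p + t ^ (-(d - σ))) * A) - (p + 1) * A := by
    calc s * ((t ^ (d - σ) - 1) * (s * A)) ≤ _ := by
          gcongr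
          exact (mul_le_mul_of_nonneg_left hρA.le htm.le).trans hlow
      _ ≤ _ := hmid
      _ = t ^ (d - α) * ((p + 1) * ∫ x, u x ^ p * u (t • x) * ‖x‖ ^ (-σ) ∂μ) - (p + 1) * A := by
          ring
      _ ≤ _ := by gcongr
  have h2 : 0 ≤ g t * A := by
    simp only [g]
    linarith
  exact absurd h2 (not_le.2 (mul_neg_of_neg_of_pos hgt hA0))

end Pohozaev

theorem stmt_12 (n : ℕ) (hn : 3 ≤ n) (α σ p : ℝ)
    (hα2 : 2 ≤ α) (hαn : α < n) (hσ : σ < α)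
    (hp1 : 1 < p) (hp : p < ((n : ℝ) + α - 2 * σ) / ((n : ℝ) - α))
    (u : EuclideanSpace ℝ (Fin n) → ℝ)
    (hupos : ∀ x, 0 < u x) (hurad : RadiallyDecreasing u) (hucont : Continuous u)
    (huC1 : ContDiffOn ℝ 1 u {(0 : EuclideanSpace ℝ (Fin n))}ᶜ)
    (hsol : ∀ x : EuclideanSpace ℝ (Fin n),
      Integrable (fun y => u y ^ p * ‖x - y‖ ^ (α - (n : ℝ)) * ‖y‖ ^ (-σ)) ∧
      u x = ∫ y, u y ^ p * ‖x - y‖ ^ (α - (n : ℝ)) * ‖y‖ ^ (-σ)) :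
    Integrable (fun x : EuclideanSpace ℝ (Fin n) =>
      u x ^ p * ‖x‖ ^ (-σ) * ⟪x, gradient u x⟫) ∧
    Integrable (fun x : EuclideanSpace ℝ (Fin n) => u x ^ (p + 1) * ‖x‖ ^ (-σ)) ∧
    (∫ x : EuclideanSpace ℝ (Fin n), u x ^ p * ‖x‖ ^ (-σ) * ⟪x, gradient u x⟫) =
      -(((n : ℝ) - α) / 2) * ∫ x : EuclideanSpace ℝ (Fin n), u x ^ (p + 1) * ‖x‖ ^ (-σ) := by
  exfalso
  obtain ⟨W, hW, -, huW⟩ := hurad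
  have hfin : Module.finrank ℝ (EuclideanSpace ℝ (Fin n)) = n := finrank_euclideanSpace_fin
  refine no_radiallyDecreasing_solution (μ := volume) (u := u) (α := α) (σ := σ) (p := p)
    (by rw [hfin]; omega) (by rwa [hfin]) hσ hp1 (by rwa [hfin]) hupos (fun x y hxy ↦ ?_) hucont
    (by rwa [hfin])
  rw [huW, huW]
  exact hW (norm_nonneg x) (norm_nonneg y) hxy
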